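/- arXiv:2512.14451 — 5 statements merged into one kernel-verified Lean document; each statement's English description precedes it below -/
import Mathlib

section
/- Solutions of the lifted system project to solutions of the bearing system: let ξ̊ ∈ ℝ³ be a unit vector, let ω, v̄ : ℝ → ℝ³ be input signals, and let X : ℝ → ℝ³ˣ³ be a differentiable matrix-valued curve with X(t) ∈ SO(3) for all t, satisfying the lifted dynamics X'(t) = X(t) S(ω(t) + v̄(t) × (X(t)ᵀξ̊)) for all t. If additionally ⟨X(t)ᵀξ̊, v̄(t)⟩ = 0 for all t, then the projected curve ξ(t) := X(t)ᵀξ̊ satisfies the bearing dynamics ξ'(t) = −S(ω(t))ξ(t) + v̄(t) for all t. -/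
open Matrix Filter
open scoped Matrix RealInnerProductSpace

noncomputable section

/-- The skew map: `skew a` is the skew-symmetric matrix `S(a)` with `S(a) b = a ×₃ b`
for all `b : Fin 3 → ℝ`. -/
def skew (a : Fin 3 → ℝ) : Matrix (Fin 3) (Fin 3) ℝ :=
  !![0, -a 2, a 1; a 2, 0, -a 0; -a 1, a 0, 0]

/-- Membership in the special orthogonal group `SO(3)`: `R Rᵀ = I` and `det R = 1`. -/
def SO3 (R : Matrix (Fin 3) (Fin 3) ℝ) : Prop :=
  R * Rᵀ = 1 ∧ R.det = 1

/-- Identification of a plain vector in `Fin 3 → ℝ` with a point of Euclidean 3-space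
(so that `‖·‖` and `⟪·,·⟫` denote the Euclidean norm and inner product). -/
def toE (v : Fin 3 → ℝ) : EuclideanSpace ℝ (Fin 3) := WithLp.toLp 2 v

attribute [local instance] Matrix.normedAddCommGroup Matrix.normedSpace

/-- solutions of the lifted system project to solutions of the bearing
system: if `X(t) ∈ SO(3)` solves `X' = X S(ω + v̄ × (Xᵀξ̊))` and `⟨Xᵀξ̊, v̄⟩ = 0`,
then `ξ(t) := X(t)ᵀ ξ̊` solves `ξ' = −S(ω) ξ + v̄`. -/
theorem lifted_solutions_project
    (ξ0 : EuclideanSpace ℝ (Fin 3)) (hξ0 : ‖ξ0‖ = 1)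
    (ω v : ℝ → Fin 3 → ℝ) (X : ℝ → Matrix (Fin 3) (Fin 3) ℝ)
    (hSO : ∀ t, SO3 (X t))
    (hdyn : ∀ t, HasDerivAt X (X t * skew (ω t + v t ⨯₃ ((X t)ᵀ *ᵥ ξ0))) t)
    (htan : ∀ t, ⟪toE ((X t)ᵀ *ᵥ ξ0), toE (v t)⟫ = 0) :
    ∀ t, HasDerivAt (fun s => (X s)ᵀ *ᵥ ξ0)
      (-(skew (ω t) *ᵥ ((X t)ᵀ *ᵥ ξ0)) + v t) t := by
  intro t
  have h1 : (ξ0 0)^2 + (ξ0 1)^2 + (ξ0 2)^2 = 1 := by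
    have h := EuclideanSpace.real_norm_sq_eq ξ0
    rw [hξ0, Fin.sum_univ_three] at h
    linarith
  have hnorm : ((X t)ᵀ *ᵥ ξ0) ⬝ᵥ ((X t)ᵀ *ᵥ ξ0) = 1 := by
    rw [Matrix.dotProduct_mulVec, Matrix.vecMul_transpose, Matrix.mulVec_mulVec, (hSO t).1,
      Matrix.one_mulVec]
    simp only [dotProduct, Fin.sum_univ_three]
    linarith
  have ht : ((X t)ᵀ *ᵥ ξ0) ⬝ᵥ v t = 0 := by
    have h := htan t
    simp only [toE, PiLp.inner_apply, Fin.sum_univ_three, RCLike.inner_apply, conj_trivial] at h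
    simp only [dotProduct, Fin.sum_univ_three] at h ⊢
    linarith
  have key : (X t * skew (ω t + v t ⨯₃ ((X t)ᵀ *ᵥ ξ0)))ᵀ *ᵥ ξ0
      = -(skew (ω t) *ᵥ ((X t)ᵀ *ᵥ ξ0)) + v t := by
    rw [Matrix.transpose_mul, ← Matrix.mulVec_mulVec]
    generalize (X t)ᵀ *ᵥ (ξ0 : Fin 3 → ℝ) = x at hnorm ht ⊢
    generalize v t = w at ht ⊢
    simp only [dotProduct, Fin.sum_univ_three] at hnorm ht
    ext i
    fin_cases i <;>
      simp [skew, Matrix.mulVec, dotProduct, Fin.sum_univ_three, cross_apply]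
    · linear_combination w 0 * hnorm - x 0 * ht
    · linear_combination w 1 * hnorm - x 1 * ht
    · linear_combination w 2 * hnorm - x 2 * ht
  rw [← key]
  have hX : ∀ i j, HasDerivAt (fun s => X s i j)
      ((X t * skew (ω t + v t ⨯₃ ((X t)ᵀ *ᵥ ξ0))) i j) t := fun i j =>
    hasDerivAt_pi.1 (hasDerivAt_pi.1 (hdyn t) i) j
  refine hasDerivAt_pi.2 fun i => ?_
  simp only [Matrix.mulVec, dotProduct, Matrix.transpose_apply, Fin.sum_univ_three]
  exact (((hX 0 i).mul_const _).add ((hX 1 i).mul_const _)).add ((hX 2 i).mul_const _)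
end
end

section
/- Error dynamics of the equivariant observer: let ξ̊ ∈ ℝ³ be a unit vector, let ω, v̄ : ℝ → ℝ³ be input signals, let Δ : ℝ → ℝ³ˣ³ take values in the skew-symmetric matrices, and let X, X̂ : ℝ → ℝ³ˣ³ be differentiable curves with X(t), X̂(t) ∈ SO(3) for all t, satisfying X'(t) = X(t) Λ(X(t)ᵀξ̊, (ω(t), v̄(t))) and X̂'(t) = X̂(t) Λ(X̂(t)ᵀξ̊, (ω(t), v̄(t))) + Δ(t) X̂(t), where Λ(ξ, (ω, v̄)) = S(ω + v̄ × ξ). Then the group error E(t) := X(t) X̂(t)ᵀ satisfies E'(t) = E(t) ( Λ(E(t)ᵀξ̊, (ω̊(t), v̄̊(t))) − Λ(ξ̊, (ω̊(t), v̄̊(t))) − Δ(t) ), where ω̊(t) = X̂(t)ω(t) and v̄̊(t) = X̂(t)v̄(t); equivalently, E'(t) = E(t) ( S(v̄̊(t) × (E(t)ᵀξ̊) − v̄̊(t) × ξ̊) − Δ(t) ). -/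
open Matrix Filter
open scoped Matrix RealInnerProductSpace

noncomputable section

attribute [local instance] Matrix.normedAddCommGroup Matrix.normedSpace

lemma skew_conj_aux (R : Matrix (Fin 3) (Fin 3) ℝ) (a : Fin 3 → ℝ) :
    Rᵀ * skew (R *ᵥ a) * R = R.det • skew a := by
  ext i j
  fin_cases i <;> fin_cases j <;>
    simp [skew, Matrix.mul_apply, Matrix.mulVec, dotProduct, Fin.sum_univ_three,
      Matrix.det_fin_three] <;> ring

lemma cross_aux (R : Matrix (Fin 3) (Fin 3) ℝ) (a b : Fin 3 → ℝ) :
    Rᵀ *ᵥ ((R *ᵥ a) ⨯₃ (R *ᵥ b)) = R.det • (a ⨯₃ b) := by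
  ext i
  fin_cases i <;>
    simp [crossProduct, Matrix.mulVec, dotProduct, Fin.sum_univ_three,
      Matrix.det_fin_three] <;> ring

lemma skew_conj {R : Matrix (Fin 3) (Fin 3) ℝ} (h : SO3 R) (a : Fin 3 → ℝ) :
    Rᵀ * skew (R *ᵥ a) = skew a * Rᵀ := by
  have h1 := skew_conj_aux R a
  rw [h.2, one_smul] at h1
  rw [← h1, Matrix.mul_assoc _ R, h.1, Matrix.mul_one]

lemma cross_equiv {R : Matrix (Fin 3) (Fin 3) ℝ} (h : SO3 R) (a b : Fin 3 → ℝ) :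
    (R *ᵥ a) ⨯₃ (R *ᵥ b) = R *ᵥ (a ⨯₃ b) := by
  have h1 := cross_aux R a b
  rw [h.2, one_smul] at h1
  rw [← h1, Matrix.mulVec_mulVec, h.1, Matrix.one_mulVec]

lemma skew_sub (a b : Fin 3 → ℝ) : skew (a - b) = skew a - skew b := by
  ext i j
  fin_cases i <;> fin_cases j <;> simp [skew] <;> ring

lemma skew_transpose (a : Fin 3 → ℝ) : (skew a)ᵀ = - skew a := by
  ext i j
  fin_cases i <;> fin_cases j <;> simp [skew]

lemma hasDerivAt_mul_transpose {X Y : ℝ → Matrix (Fin 3) (Fin 3) ℝ}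
    {X' Y' : Matrix (Fin 3) (Fin 3) ℝ} {t : ℝ}
    (hX : HasDerivAt X X' t) (hY : HasDerivAt Y Y' t) :
    HasDerivAt (fun s => X s * (Y s)ᵀ) (X' * (Y t)ᵀ + X t * Y'ᵀ) t := by
  have eX : ∀ i j, HasDerivAt (fun s => X s i j) (X' i j) t := fun i j =>
    hasDerivAt_pi.1 (hasDerivAt_pi.1 hX i) j
  have eY : ∀ i j, HasDerivAt (fun s => Y s i j) (Y' i j) t := fun i j =>
    hasDerivAt_pi.1 (hasDerivAt_pi.1 hY i) j
  refine hasDerivAt_pi.2 fun i => hasDerivAt_pi.2 fun j => ?_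
  have := HasDerivAt.fun_sum (u := Finset.univ) fun k _ => (eX i k).mul (eY j k)
  convert this using 1
  · simp [Matrix.mul_apply]
  · rw [Finset.sum_add_distrib, Matrix.add_apply, Matrix.mul_apply, Matrix.mul_apply]
    rfl

/-- error dynamics of the equivariant observer: with lifted system
`X' = X Λ(Xᵀξ̊, u)`, observer `X̂' = X̂ Λ(X̂ᵀξ̊, u) + Δ X̂` (`Δ` skew-symmetric), the
group error `E = X X̂ᵀ` satisfies
`E' = E (Λ(Eᵀξ̊, (ω̊, v̊)) − Λ(ξ̊, (ω̊, v̊)) − Δ) = E (S(v̊ × (Eᵀξ̊) − v̊ × ξ̊) − Δ)`,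
where `ω̊ = X̂ω`, `v̊ = X̂v̄` and `Λ(ξ, (ω, v̄)) = S(ω + v̄ × ξ)`. -/
theorem group_error_dynamics
    (ξ0 : EuclideanSpace ℝ (Fin 3)) (hξ0 : ‖ξ0‖ = 1)
    (ω v : ℝ → Fin 3 → ℝ) (Δ : ℝ → Matrix (Fin 3) (Fin 3) ℝ)
    (hΔ : ∀ t, (Δ t)ᵀ = -(Δ t))
    (X Xhat : ℝ → Matrix (Fin 3) (Fin 3) ℝ)
    (hXSO : ∀ t, SO3 (X t)) (hXhatSO : ∀ t, SO3 (Xhat t))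
    (hX : ∀ t, HasDerivAt X (X t * skew (ω t + v t ⨯₃ ((X t)ᵀ *ᵥ ξ0.ofLp))) t)
    (hXhat : ∀ t, HasDerivAt Xhat
      (Xhat t * skew (ω t + v t ⨯₃ ((Xhat t)ᵀ *ᵥ ξ0.ofLp)) + Δ t * Xhat t) t) :
    (∀ t, HasDerivAt (fun s => X s * (Xhat s)ᵀ)
      (X t * (Xhat t)ᵀ *
        (skew ((Xhat t *ᵥ ω t) + (Xhat t *ᵥ v t) ⨯₃ ((X t * (Xhat t)ᵀ)ᵀ *ᵥ ξ0.ofLp))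
          - skew ((Xhat t *ᵥ ω t) + (Xhat t *ᵥ v t) ⨯₃ ξ0.ofLp) - Δ t)) t)
    ∧ (∀ t, HasDerivAt (fun s => X s * (Xhat s)ᵀ)
      (X t * (Xhat t)ᵀ *
        (skew ((Xhat t *ᵥ v t) ⨯₃ ((X t * (Xhat t)ᵀ)ᵀ *ᵥ ξ0.ofLp)
            - (Xhat t *ᵥ v t) ⨯₃ ξ0.ofLp) - Δ t)) t) := by
  have key : ∀ t, HasDerivAt (fun s => X s * (Xhat s)ᵀ)
      (X t * (Xhat t)ᵀ *
        (skew ((Xhat t *ᵥ ω t) + (Xhat t *ᵥ v t) ⨯₃ ((X t * (Xhat t)ᵀ)ᵀ *ᵥ ξ0.ofLp))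
          - skew ((Xhat t *ᵥ ω t) + (Xhat t *ᵥ v t) ⨯₃ ξ0.ofLp) - Δ t)) t := by
    intro t
    have h := hXhatSO t
    have e1 : (Xhat t *ᵥ ω t) + (Xhat t *ᵥ v t) ⨯₃ ((X t * (Xhat t)ᵀ)ᵀ *ᵥ ξ0.ofLp)
        = Xhat t *ᵥ (ω t + v t ⨯₃ ((X t)ᵀ *ᵥ ξ0.ofLp)) := by
      rw [Matrix.transpose_mul, Matrix.transpose_transpose, ← Matrix.mulVec_mulVec,
        cross_equiv h, Matrix.mulVec_add]
    have e2 : (Xhat t *ᵥ ω t) + (Xhat t *ᵥ v t) ⨯₃ ξ0.ofLp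
        = Xhat t *ᵥ (ω t + v t ⨯₃ ((Xhat t)ᵀ *ᵥ ξ0.ofLp)) := by
      rw [Matrix.mulVec_add, ← cross_equiv h, Matrix.mulVec_mulVec, h.1, Matrix.one_mulVec]
    have hd := hasDerivAt_mul_transpose (hX t) (hXhat t)
    rw [e1, e2]
    convert hd using 1
    rw [Matrix.transpose_add, Matrix.transpose_mul, Matrix.transpose_mul, hΔ, skew_transpose,
      Matrix.mul_assoc, Matrix.mul_sub (Xhat t)ᵀ, Matrix.mul_sub (Xhat t)ᵀ, skew_conj h, skew_conj h]
    noncomm_ring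
  refine ⟨key, fun t => ?_⟩
  have := key t
  rwa [← skew_sub, add_sub_add_left_eq_sub] at this
end
end

section
/- Lyapunov decrease along closed-loop error trajectories: let ξ̊ ∈ ℝ³ be a unit vector, k > 0, and let E : ℝ → ℝ³ˣ³ be a differentiable curve with E(t) ∈ SO(3) for all t satisfying E'(t) = −k E(t) S((E(t)ᵀξ̊) × ξ̊). Then the function t ↦ V(E(t)) := 1 − ⟨ξ̊, E(t) ξ̊⟩ is differentiable with derivative d/dt V(E(t)) = −k ‖(E(t)ᵀξ̊) × ξ̊‖² ≤ 0 for all t; in particular V(E(t)) is nonincreasing. -/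
open Matrix Filter
open scoped Matrix RealInnerProductSpace

noncomputable section

attribute [local instance] Matrix.normedAddCommGroup Matrix.normedSpace

/-- Lyapunov decrease along closed-loop error trajectories: if
`E(t) ∈ SO(3)` solves `E' = −k E S((Eᵀξ̊) × ξ̊)` with `k > 0`, then
`t ↦ V(E(t)) := 1 − ⟨ξ̊, E(t) ξ̊⟩` is differentiable with derivative
`−k ‖(E(t)ᵀξ̊) × ξ̊‖² ≤ 0`; in particular `V(E(t))` is nonincreasing. -/
theorem lyapunov_decrease
    (ξ0 : EuclideanSpace ℝ (Fin 3)) (hξ0 : ‖ξ0‖ = 1) (k : ℝ) (hk : 0 < k)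
    (E : ℝ → Matrix (Fin 3) (Fin 3) ℝ) (hSO : ∀ t, SO3 (E t))
    (hdyn : ∀ t, HasDerivAt E ((-k) • (E t * skew (((E t)ᵀ *ᵥ ξ0) ⨯₃ ξ0))) t) :
    (∀ t, HasDerivAt (fun s => 1 - ⟪ξ0, toE (E s *ᵥ ξ0)⟫)
        (-k * ‖toE (((E t)ᵀ *ᵥ ξ0) ⨯₃ ξ0)‖ ^ 2) t
      ∧ -k * ‖toE (((E t)ᵀ *ᵥ ξ0) ⨯₃ ξ0)‖ ^ 2 ≤ 0)
    ∧ Antitone (fun t => 1 - ⟪ξ0, toE (E t *ᵥ ξ0)⟫) := by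
  have key : ∀ t, HasDerivAt (fun s => 1 - ⟪ξ0, toE (E s *ᵥ ξ0)⟫)
        (-k * ‖toE (((E t)ᵀ *ᵥ ξ0) ⨯₃ ξ0)‖ ^ 2) t := by
    intro t
    have hE : ∀ i j, HasDerivAt (fun s => E s i j)
        (((-k) • (E t * skew (((E t)ᵀ *ᵥ ξ0) ⨯₃ ξ0))) i j) t := by
      intro i j
      exact hasDerivAt_pi.1 (hasDerivAt_pi.1 (hdyn t) i) j
    have h1 : HasDerivAt (fun s => 1 - ∑ i, ∑ j, E s i j * ξ0 j * ξ0 i)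
        (-(∑ i, ∑ j,
          ((-k) • (E t * skew (((E t)ᵀ *ᵥ ξ0) ⨯₃ ξ0))) i j * ξ0 j * ξ0 i)) t := by
      apply HasDerivAt.const_sub
      apply HasDerivAt.fun_sum
      intro i _
      apply HasDerivAt.fun_sum
      intro j _
      exact ((hE i j).mul_const _).mul_const _
    convert h1 using 1
    · funext s
      simp [toE, PiLp.inner_apply, Matrix.mulVec, dotProduct, Fin.sum_univ_three]
      ring
    · rw [EuclideanSpace.norm_sq_eq]
      simp [toE, skew, crossProduct, Matrix.mulVec, dotProduct, Fin.sum_univ_three,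
        Matrix.mul_apply]
      ring
  have hle : ∀ t, -k * ‖toE (((E t)ᵀ *ᵥ ξ0) ⨯₃ ξ0)‖ ^ 2 ≤ 0 := by
    intro t
    have := mul_nonneg hk.le (sq_nonneg ‖toE (((E t)ᵀ *ᵥ ξ0) ⨯₃ ξ0)‖)
    linarith
  refine ⟨fun t => ⟨key t, hle t⟩, ?_⟩
  apply antitone_of_deriv_nonpos
  · exact fun t => (key t).differentiableAt
  · intro t
    rw [(key t).deriv]
    exact hle t
end
end

section
/- Almost global asymptotic convergence of the error system: let ξ̊ ∈ ℝ³ be a unit vector, k > 0, and let E : ℝ → ℝ³ˣ³ be a differentiable curve with E(t) ∈ SO(3) for all t ≥ 0, satisfying the closed-loop error dynamics E'(t) = −k E(t) S((E(t)ᵀξ̊) × ξ̊). If the initial condition satisfies E(0)ᵀξ̊ ≠ −ξ̊, then E(t)ᵀξ̊ → ξ̊ as t → ∞; equivalently, the global state error e(t) := E(t)ᵀξ̊ converges to the origin ξ̊ of the coordinate system. -/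
open Matrix Filter
open scoped Matrix RealInnerProductSpace

noncomputable section

attribute [local instance] Matrix.normedAddCommGroup Matrix.normedSpace

lemma skew_quad (e x : Fin 3 → ℝ) :
    e ⬝ᵥ (skew (e ⨯₃ x) *ᵥ x) = (e ⬝ᵥ x) ^ 2 - (e ⬝ᵥ e) * (x ⬝ᵥ x) := by
  simp [skew, cross_apply, Matrix.mulVec, dotProduct, Fin.sum_univ_three]
  ring

lemma scalar_decay (k : ℝ) (hk : 0 < k) (c : ℝ → ℝ)
    (hle : ∀ t, 0 ≤ t → c t ≤ 1) (hge : ∀ t, 0 ≤ t → -1 ≤ c t)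
    (hd : ∀ t, 0 ≤ t → HasDerivAt c (k * (1 - c t ^ 2)) t) (h0 : c 0 ≠ -1) :
    Tendsto c atTop (nhds 1) := by
  have hw : 0 < 1 + c 0 := by
    rcases lt_or_eq_of_le (hge 0 le_rfl) with h | h
    · linarith
    · exact absurd h.symm h0
  have hmono : MonotoneOn c (Set.Ici 0) := by
    apply monotoneOn_of_hasDerivWithinAt_nonneg (convex_Ici 0)
      (fun t ht => (hd t ht).continuousAt.continuousWithinAt)
      (f' := fun t => k * (1 - c t ^ 2))
    · intro t ht
      rw [interior_Ici] at ht
      exact (hd t (le_of_lt ht)).hasDerivWithinAt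
    · intro t ht
      rw [interior_Ici] at ht
      have h1 := hle t (le_of_lt ht)
      have h2 := hge t (le_of_lt ht)
      have : 0 ≤ 1 - c t ^ 2 := by nlinarith
      positivity
  set a := k * (1 + c 0) with ha
  have hapos : 0 < a := by positivity
  have hg : ∀ t, 0 ≤ t → HasDerivAt (fun t => (1 - c t) * Real.exp (a * t))
      (-(k * (1 - c t ^ 2)) * Real.exp (a * t) + (1 - c t) * (Real.exp (a * t) * a)) t := by
    intro t ht
    have h1 := (hd t ht).const_sub 1
    have h2 : HasDerivAt (fun t => Real.exp (a * t)) (Real.exp (a * t) * a) t := by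
      simpa using ((hasDerivAt_id t).const_mul a).exp
    exact h1.mul h2
  have hanti : AntitoneOn (fun t => (1 - c t) * Real.exp (a * t)) (Set.Ici 0) := by
    apply antitoneOn_of_hasDerivWithinAt_nonpos (convex_Ici 0)
      (fun t ht => (hg t ht).continuousAt.continuousWithinAt)
      (f' := fun t => (-(k * (1 - c t ^ 2)) * Real.exp (a * t)
        + (1 - c t) * (Real.exp (a * t) * a)))
    · intro t ht
      rw [interior_Ici] at ht
      exact (hg t (le_of_lt ht)).hasDerivWithinAt
    · intro t ht
      rw [interior_Ici] at ht
      have ht' : 0 ≤ t := le_of_lt ht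
      have h1 := hle t ht'
      have h2 : c 0 ≤ c t := hmono (Set.mem_Ici.2 le_rfl) ht' ht'
      have h3 := Real.exp_pos (a * t)
      have : 0 ≤ k * Real.exp (a * t) * ((1 - c t) * (c t - c 0)) :=
        mul_nonneg (by positivity) (mul_nonneg (by linarith) (by linarith))
      rw [ha] at this ⊢
      nlinarith
  have hbound : ∀ t, 0 ≤ t → 1 - (1 - c 0) * Real.exp (-(a * t)) ≤ c t := by
    intro t ht
    have h := hanti (Set.mem_Ici.2 le_rfl) (Set.mem_Ici.2 ht) ht
    simp only [mul_zero, Real.exp_zero, mul_one] at h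
    have h3 := Real.exp_pos (-(a * t))
    have h4 : Real.exp (a * t) * Real.exp (-(a * t)) = 1 := by
      rw [← Real.exp_add]; simp
    have h5 := mul_le_mul_of_nonneg_right h h3.le
    rw [mul_assoc, h4] at h5
    linarith
  have hlim : Tendsto (fun t => 1 - (1 - c 0) * Real.exp (-(a * t))) atTop (nhds 1) := by
    have h1 : Tendsto (fun t : ℝ => Real.exp (-(a * t))) atTop (nhds 0) :=
      Real.tendsto_exp_neg_atTop_nhds_zero.comp (tendsto_id.const_mul_atTop hapos)
    simpa using (h1.const_mul (1 - c 0)).const_sub 1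
  refine tendsto_of_tendsto_of_tendsto_of_le_of_le' hlim tendsto_const_nhds ?_ ?_
  · filter_upwards [eventually_ge_atTop 0] with t ht using hbound t ht
  · filter_upwards [eventually_ge_atTop 0] with t ht using hle t ht

/-- almost global asymptotic convergence of the error system: if
`E(t) ∈ SO(3)` solves `E' = −k E S((Eᵀξ̊) × ξ̊)` for all `t ≥ 0` with `k > 0`, and the
initial condition satisfies `E(0)ᵀξ̊ ≠ −ξ̊`, then `E(t)ᵀξ̊ → ξ̊` as `t → ∞`. -/
theorem almost_global_convergence
    (ξ0 : EuclideanSpace ℝ (Fin 3)) (hξ0 : ‖ξ0‖ = 1) (k : ℝ) (hk : 0 < k)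
    (E : ℝ → Matrix (Fin 3) (Fin 3) ℝ)
    (hSO : ∀ t : ℝ, 0 ≤ t → SO3 (E t))
    (hdyn : ∀ t : ℝ, 0 ≤ t →
      HasDerivAt E ((-k) • (E t * skew (((E t)ᵀ *ᵥ ξ0) ⨯₃ ξ0))) t)
    (hinit : (E 0)ᵀ *ᵥ ξ0 ≠ -ξ0) :
    Tendsto (fun t => toE ((E t)ᵀ *ᵥ ξ0)) atTop (nhds ξ0) := by
  have hxx : ξ0.ofLp ⬝ᵥ ξ0.ofLp = 1 := by
    have h := EuclideanSpace.real_norm_sq_eq ξ0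
    rw [hξ0] at h
    simp only [dotProduct, ← pow_two]
    rw [← h]; norm_num
  have hee : ∀ t, 0 ≤ t → ((E t)ᵀ *ᵥ ξ0.ofLp) ⬝ᵥ ((E t)ᵀ *ᵥ ξ0.ofLp) = 1 := by
    intro t ht
    rw [Matrix.dotProduct_mulVec, Matrix.vecMul_transpose, Matrix.mulVec_mulVec,
      (hSO t ht).1, Matrix.one_mulVec, hxx]
  have hsub : ∀ t, 0 ≤ t → ((E t)ᵀ *ᵥ ξ0.ofLp - ξ0.ofLp) ⬝ᵥ ((E t)ᵀ *ᵥ ξ0.ofLp - ξ0.ofLp)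
      = 2 * (1 - ((E t)ᵀ *ᵥ ξ0.ofLp) ⬝ᵥ ξ0.ofLp) := by
    intro t ht
    rw [sub_dotProduct, dotProduct_sub, dotProduct_sub, hee t ht, hxx,
      dotProduct_comm ξ0.ofLp ((E t)ᵀ *ᵥ ξ0.ofLp)]
    ring
  have hadd : ∀ t, 0 ≤ t → ((E t)ᵀ *ᵥ ξ0.ofLp + ξ0.ofLp) ⬝ᵥ ((E t)ᵀ *ᵥ ξ0.ofLp + ξ0.ofLp)
      = 2 * (1 + ((E t)ᵀ *ᵥ ξ0.ofLp) ⬝ᵥ ξ0.ofLp) := by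
    intro t ht
    rw [add_dotProduct, dotProduct_add, dotProduct_add, hee t ht, hxx,
      dotProduct_comm ξ0.ofLp ((E t)ᵀ *ᵥ ξ0.ofLp)]
    ring
  have hnn : ∀ v : Fin 3 → ℝ, 0 ≤ v ⬝ᵥ v := fun v =>
    Finset.sum_nonneg (fun i _ => mul_self_nonneg (v i))
  have hlim : Tendsto (fun t => ((E t)ᵀ *ᵥ ξ0.ofLp) ⬝ᵥ ξ0.ofLp) atTop (nhds 1) := by
    apply scalar_decay k hk
    · intro t ht
      have := hnn ((E t)ᵀ *ᵥ ξ0.ofLp - ξ0.ofLp)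
      rw [hsub t ht] at this
      linarith
    · intro t ht
      have := hnn ((E t)ᵀ *ᵥ ξ0.ofLp + ξ0.ofLp)
      rw [hadd t ht] at this
      linarith
    · intro t ht
      have hE := hdyn t ht
      have hij : ∀ i j, HasDerivAt (fun s => E s i j)
          (((-k) • (E t * skew (((E t)ᵀ *ᵥ ξ0.ofLp) ⨯₃ ξ0.ofLp))) i j) t := fun i j =>
        hasDerivAt_pi.1 (hasDerivAt_pi.1 hE i) j
      have h1 : HasDerivAt (fun s => ((E s)ᵀ *ᵥ ξ0.ofLp) ⬝ᵥ ξ0.ofLp)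
          ((((-k) • (E t * skew (((E t)ᵀ *ᵥ ξ0.ofLp) ⨯₃ ξ0.ofLp)))ᵀ *ᵥ ξ0.ofLp)
            ⬝ᵥ ξ0.ofLp) t := by
        simp only [dotProduct, Matrix.mulVec]
        refine HasDerivAt.fun_sum (fun i _ => HasDerivAt.mul_const ?_ _)
        refine HasDerivAt.fun_sum (fun j _ => HasDerivAt.mul_const ?_ _)
        exact hij j i
      convert h1 using 1
      have h2 := skew_quad ((E t)ᵀ *ᵥ ξ0.ofLp) ξ0.ofLp
      rw [hee t ht, hxx] at h2
      generalize skew (((E t)ᵀ *ᵥ ξ0.ofLp) ⨯₃ ξ0.ofLp) = M at h2 ⊢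
      rw [Matrix.mulVec_transpose ((-k) • (E t * M)), ← Matrix.dotProduct_mulVec ξ0.ofLp ((-k) • (E t * M)), Matrix.smul_mulVec,
        dotProduct_smul, ← Matrix.mulVec_mulVec, Matrix.dotProduct_mulVec,
        ← Matrix.mulVec_transpose, h2, smul_eq_mul]
      ring
    · intro h
      have h3 := hadd 0 le_rfl
      rw [h] at h3
      rw [add_neg_cancel, mul_zero] at h3
      exact hinit (eq_neg_of_add_eq_zero_left (dotProduct_self_eq_zero.1 h3))
  rw [tendsto_iff_norm_sub_tendsto_zero]
  have h2 : Tendsto (fun t => Real.sqrt (2 * (1 - ((E t)ᵀ *ᵥ ξ0.ofLp) ⬝ᵥ ξ0.ofLp)))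
      atTop (nhds 0) := by
    have := ((hlim.const_sub 1).const_mul 2).sqrt
    simpa using this
  refine h2.congr' ?_
  filter_upwards [eventually_ge_atTop 0] with t ht
  rw [← hsub t ht, EuclideanSpace.norm_eq]
  simp [dotProduct, toE, pow_two]
end
end

section
/- Observer on the manifold: let ξ̊ ∈ ℝ³ be a unit vector, k > 0, let ω, v̄, y : ℝ → ℝ³ be signals, and let X̂ : ℝ → ℝ³ˣ³ be a differentiable curve with X̂(t) ∈ SO(3) for all t satisfying the observer dynamics X̂'(t) = X̂(t) S(ω(t) + v̄(t) × (X̂(t)ᵀξ̊)) + Δ(t) X̂(t) with correction term Δ(t) = S( (X̂(t)v̄(t)) × (X̂(t)y(t)) − (X̂(t)v̄(t)) × ξ̊ + k (X̂(t)y(t)) × ξ̊ ). Then the manifold estimate ξ̂(t) := X̂(t)ᵀξ̊ satisfies ξ̂'(t) = −S(ω(t) + v̄(t) × y(t)) ξ̂(t) + k Π_{ξ̂(t)} y(t), where Π_y = I − yyᵀ. -/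
open Matrix Filter
open scoped Matrix RealInnerProductSpace

noncomputable section

attribute [local instance] Matrix.normedAddCommGroup Matrix.normedSpace

theorem skew_mulVec_eq (a b : Fin 3 → ℝ) : skew a *ᵥ b = a ⨯₃ b := by
  ext i
  fin_cases i <;>
    simp [skew, Matrix.mulVec, dotProduct, Fin.sum_univ_three, crossProduct] <;> ring

theorem skew_transpose_eq (a : Fin 3 → ℝ) : (skew a)ᵀ = -skew a := by
  ext i j
  fin_cases i <;> fin_cases j <;> simp [skew]

theorem transpose_mulVec_cross (M : Matrix (Fin 3) (Fin 3) ℝ) (a b : Fin 3 → ℝ) :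
    Mᵀ *ᵥ ((M *ᵥ a) ⨯₃ (M *ᵥ b)) = M.det • (a ⨯₃ b) := by
  ext i
  fin_cases i <;>
    simp [Matrix.det_fin_three, Matrix.mulVec, dotProduct, Fin.sum_univ_three, crossProduct] <;>
    ring

theorem SO3.cross {M : Matrix (Fin 3) (Fin 3) ℝ} (h : SO3 M) (a b : Fin 3 → ℝ) :
    (M *ᵥ a) ⨯₃ (M *ᵥ b) = M *ᵥ (a ⨯₃ b) := by
  have h1 := congrArg (fun u => M *ᵥ u) (transpose_mulVec_cross M a b)
  simpa [Matrix.mulVec_mulVec, h.1, h.2] using h1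

theorem cross_identity (w v y x : Fin 3 → ℝ) (k : ℝ) (hx : x ⬝ᵥ x = 1) :
    -((w + v ⨯₃ x) ⨯₃ x) + -((v ⨯₃ y - v ⨯₃ x + k • (y ⨯₃ x)) ⨯₃ x)
      = -((w + v ⨯₃ y) ⨯₃ x)
        + k • (((1 : Matrix (Fin 3) (Fin 3) ℝ) - vecMulVec x x) *ᵥ y) := by
  simp only [dotProduct, Fin.sum_univ_three] at hx
  ext i
  fin_cases i <;>
    simp [Matrix.sub_mulVec, Matrix.mulVec, vecMulVec, dotProduct, Fin.sum_univ_three,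
      crossProduct]
  · linear_combination (k * y 0) * hx
  · linear_combination (k * y 1) * hx
  · linear_combination (k * y 2) * hx

/-- observer on the manifold: if `X̂(t) ∈ SO(3)` solves
`X̂' = X̂ S(ω + v̄ × (X̂ᵀξ̊)) + Δ X̂` with correction term
`Δ = S((X̂v̄) × (X̂y) − (X̂v̄) × ξ̊ + k (X̂y) × ξ̊)`, then the manifold estimate
`ξ̂ := X̂ᵀξ̊` satisfies `ξ̂' = −S(ω + v̄ × y) ξ̂ + k Π_{ξ̂} y` with `Π_y = I − y yᵀ`. -/
theorem observer_on_manifold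
    (ξ0 : EuclideanSpace ℝ (Fin 3)) (hξ0 : ‖ξ0‖ = 1) (k : ℝ) (hk : 0 < k)
    (ω v y : ℝ → Fin 3 → ℝ) (Xhat : ℝ → Matrix (Fin 3) (Fin 3) ℝ)
    (hSO : ∀ t, SO3 (Xhat t))
    (hdyn : ∀ t, HasDerivAt Xhat
      (Xhat t * skew (ω t + v t ⨯₃ ((Xhat t)ᵀ *ᵥ ξ0.ofLp))
        + skew ((Xhat t *ᵥ v t) ⨯₃ (Xhat t *ᵥ y t) - (Xhat t *ᵥ v t) ⨯₃ ξ0.ofLp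
            + k • ((Xhat t *ᵥ y t) ⨯₃ ξ0.ofLp)) * Xhat t) t) :
    ∀ t, HasDerivAt (fun s => (Xhat s)ᵀ *ᵥ ξ0.ofLp)
      (-(skew (ω t + v t ⨯₃ y t) *ᵥ ((Xhat t)ᵀ *ᵥ ξ0.ofLp))
        + k • (((1 : Matrix (Fin 3) (Fin 3) ℝ)
            - vecMulVec ((Xhat t)ᵀ *ᵥ ξ0.ofLp) ((Xhat t)ᵀ *ᵥ ξ0.ofLp)) *ᵥ y t)) t := by
  intro t
  have hder : HasDerivAt (fun s => (Xhat s)ᵀ *ᵥ ξ0.ofLp)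
      ((Xhat t * skew (ω t + v t ⨯₃ ((Xhat t)ᵀ *ᵥ ξ0.ofLp))
        + skew ((Xhat t *ᵥ v t) ⨯₃ (Xhat t *ᵥ y t) - (Xhat t *ᵥ v t) ⨯₃ ξ0.ofLp
            + k • ((Xhat t *ᵥ y t) ⨯₃ ξ0.ofLp)) * Xhat t)ᵀ *ᵥ ξ0.ofLp) t := by
    have h := hdyn t
    rw [hasDerivAt_pi]
    intro i
    simp only [Matrix.mulVec, dotProduct, Matrix.transpose_apply]
    refine HasDerivAt.fun_sum fun j _ => ?_
    exact ((hasDerivAt_pi.1 ((hasDerivAt_pi.1 h) j)) i).mul_const _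
  convert hder using 1
  have hS := hSO t
  generalize Xhat t = M at hS
  obtain ⟨x, hx⟩ : ∃ x, x = Mᵀ *ᵥ ξ0.ofLp := ⟨_, rfl⟩
  have hMx : ξ0.ofLp = M *ᵥ x := by rw [hx, Matrix.mulVec_mulVec, hS.1, Matrix.one_mulVec]
  have hMM : Mᵀ * M = 1 := mul_eq_one_comm.1 hS.1
  have hxx : x ⬝ᵥ x = 1 := by
    have h1 : ξ0.ofLp ⬝ᵥ ξ0.ofLp = 1 := by
      have h2 := EuclideanSpace.real_norm_sq_eq ξ0
      rw [hξ0] at h2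
      simp only [dotProduct, ← pow_two]
      linarith
    have h3 : x ⬝ᵥ x = ξ0.ofLp ⬝ᵥ (M *ᵥ x) := by
      rw [Matrix.dotProduct_mulVec, ← Matrix.mulVec_transpose, ← hx]
    rw [h3, ← hMx, h1]
  rw [← hx, hMx, hS.cross, hS.cross, hS.cross, ← Matrix.mulVec_smul M, ← Matrix.mulVec_sub,
    ← Matrix.mulVec_add, Matrix.transpose_add, Matrix.add_mulVec, Matrix.transpose_mul,
    Matrix.transpose_mul, skew_transpose_eq, skew_transpose_eq, ← Matrix.mulVec_mulVec,
    ← Matrix.mulVec_mulVec, Matrix.mulVec_mulVec x Mᵀ M, hMM, Matrix.one_mulVec,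
    Matrix.neg_mulVec, Matrix.neg_mulVec, skew_mulVec_eq, skew_mulVec_eq, skew_mulVec_eq,
    hS.cross, Matrix.mulVec_neg, Matrix.mulVec_mulVec _ Mᵀ M, hMM, Matrix.one_mulVec]
  exact (cross_identity _ _ _ _ _ hxx).symm
end
end
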